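/- Let A be an abelian algebra and θ a nontrivial strongly abelian congruence on A. Let A(θ) be the substructure of A × A with universe {(x,y) | x θ y}, D the diagonal, Δ the smallest congruence of A(θ) containing D × D, S = A(θ)/Δ, and 0 ∈ S the Δ-class of the diagonal. Then S has Property P: for every polynomial operation P of S of arity n and every tuple s ∈ S^n, if P(s) = 0 then P(0,…,0) = 0. -/

import Mathlib

namespace UA

/-- An algebraic language: a type of operation symbols with arities. -/
structure Lang where
  F : Type
  arity : F → ℕ

variable {L : Lang}

/-- An interpretation of the language `L` on the carrier `A` (an algebra structure). -/
def Interp (L : Lang) (A : Type) : Type :=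
  (f : L.F) → ((Fin (L.arity f)) → A) → A

/-- Terms of the language `L` over a type `X` of variables. -/
inductive Term (L : Lang) (X : Type) : Type
  | var : X → Term L X
  | app : (f : L.F) → ((Fin (L.arity f)) → Term L X) → Term L X

/-- Realization of a term under an assignment of the variables. -/
def Term.realize {A X : Type} (I : Interp L A) (v : X → A) : Term L X → A
  | .var x => v x
  | .app f ts => I f (fun i => (ts i).realize I v)

/-- Relabelling (substitution of variables) of terms. -/
def Term.relabel {X Y : Type} (g : X → Y) : Term L X → Term L Y
  | .var x => .var (g x)
  | .app f ts => .app f (fun i => (ts i).relabel g)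

/-- `p` is a polynomial operation of the algebra `(A, I)` with argument-index type `X`:
it is the realization of a term in variables `X ⊕ Fin m` where the `Fin m` variables
are evaluated at fixed constants. -/
def IsPolyOp {A X : Type} (I : Interp L A) (p : (X → A) → A) : Prop :=
  ∃ (m : ℕ) (t : Term L (X ⊕ Fin m)) (c : Fin m → A),
    ∀ x : X → A, p x = t.realize I (Sum.elim x c)

/-- A unary polynomial operation. -/
def IsUnaryPolyOp {A : Type} (I : Interp L A) (g : A → A) : Prop :=
  IsPolyOp I (fun x : Fin 1 → A => g (x 0))

/-- `(p, q, r, s)` is a `1,1`-matrix of the algebra `(A, I)`. -/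
def Is11Matrix {A : Type} (I : Interp L A) (p q r s : A) : Prop :=
  ∃ (k l : ℕ) (t : ((Fin k ⊕ Fin l) → A) → A), IsPolyOp I t ∧
    ∃ (a b : Fin k → A) (u v : Fin l → A),
      p = t (Sum.elim a u) ∧ q = t (Sum.elim a v) ∧
      r = t (Sum.elim b u) ∧ s = t (Sum.elim b v)

/-- The algebra is abelian: in every `1,1`-matrix, `p = q` implies `r = s`. -/
def IsAbelian {A : Type} (I : Interp L A) : Prop :=
  ∀ p q r s : A, Is11Matrix I p q r s → p = q → r = s

/-- The algebra is strongly rectangular: in every `1,1`-matrix, `q = r` implies `r = s`. -/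
def IsStronglyRectangular {A : Type} (I : Interp L A) : Prop :=
  ∀ p q r s : A, Is11Matrix I p q r s → q = r → r = s

/-- Strongly abelian = abelian + strongly rectangular. -/
def IsStronglyAbelian {A : Type} (I : Interp L A) : Prop :=
  IsAbelian I ∧ IsStronglyRectangular I

/-- The algebra has a Maltsev polynomial operation. -/
def HasMaltsevPoly {A : Type} (I : Interp L A) : Prop :=
  ∃ mOp : (Fin 3 → A) → A, IsPolyOp I mOp ∧
    ∀ x y : A, mOp ![x, y, y] = x ∧ mOp ![y, y, x] = x

/-- Affine = abelian + has a Maltsev polynomial operation. -/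
def IsAffine {A : Type} (I : Interp L A) : Prop :=
  IsAbelian I ∧ HasMaltsevPoly I

/-- The algebra satisfies the identity `e.1 ≈ e.2`. -/
def Satisfies {A : Type} (I : Interp L A) (e : Term L ℕ × Term L ℕ) : Prop :=
  ∀ v : ℕ → A, e.1.realize I v = e.2.realize I v

/-- Membership in the variety `Mod(E)` axiomatized by the set `E` of identities. -/
def InVariety {A : Type} (E : Set (Term L ℕ × Term L ℕ)) (I : Interp L A) : Prop :=
  ∀ e ∈ E, Satisfies I e

/-- `θ` is a congruence on the algebra `(A, I)`. -/
def IsCong {A : Type} (I : Interp L A) (θ : A → A → Prop) : Prop :=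
  Equivalence θ ∧
    ∀ (f : L.F) (a b : Fin (L.arity f) → A),
      (∀ i, θ (a i) (b i)) → θ (I f a) (I f b)

/-- `(p, q, r, s)` is a `θ`-matrix of the algebra `(A, I)`. -/
def IsThetaMatrix {A : Type} (I : Interp L A) (θ : A → A → Prop) (p q r s : A) : Prop :=
  ∃ (k l : ℕ) (t : ((Fin k ⊕ Fin l) → A) → A), IsPolyOp I t ∧
    ∃ (a b : Fin k → A) (u v : Fin l → A),
      (∀ i, θ (a i) (b i)) ∧ (∀ j, θ (u j) (v j)) ∧
      p = t (Sum.elim a u) ∧ q = t (Sum.elim a v) ∧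
      r = t (Sum.elim b u) ∧ s = t (Sum.elim b v)

/-- `θ` is a strongly abelian congruence. -/
def IsStronglyAbelianCong {A : Type} (I : Interp L A) (θ : A → A → Prop) : Prop :=
  ∀ p q r s : A, IsThetaMatrix I θ p q r s → (p = q → r = s) ∧ (q = r → r = s)

/-- `S` is a subuniverse of the algebra `(A, I)`. -/
def IsSubuniverse {A : Type} (I : Interp L A) (S : Set A) : Prop :=
  ∀ (f : L.F) (a : Fin (L.arity f) → A), (∀ i, a i ∈ S) → I f a ∈ S

/-- The substructure (restricted algebra structure) on a subuniverse. -/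
def subInterp {A : Type} (I : Interp L A) (S : Set A) (hS : IsSubuniverse I S) :
    Interp L S :=
  fun f a => ⟨I f (fun i => (a i : A)), hS f _ (fun i => (a i).2)⟩

/-- The componentwise algebra structure on a product. -/
def prodInterp {ι : Type} {A : ι → Type} (I : ∀ i, Interp L (A i)) :
    Interp L (∀ i, A i) :=
  fun f a i => I i f (fun j => a j i)

/-- The componentwise algebra structure on `A × A`. -/
def pairInterp {A : Type} (I : Interp L A) : Interp L (A × A) :=
  fun f a => (I f (fun i => (a i).1), I f (fun i => (a i).2))

/-- `h` is a homomorphism of `L`-algebras. -/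
def IsHom {A B : Type} (I : Interp L A) (J : Interp L B) (h : A → B) : Prop :=
  ∀ (f : L.F) (a : Fin (L.arity f) → A), h (I f a) = J f (fun i => h (a i))

/-- The induced algebra structure on the quotient by a congruence `ρ`
(well-defined, i.e. independent of the chosen representatives, when `ρ` is a congruence). -/
noncomputable def quotInterp {A : Type} (I : Interp L A) (ρ : A → A → Prop) :
    Interp L (Quot ρ) :=
  fun f a => Quot.mk ρ (I f (fun i => (a i).out))

/-- The subuniverse generated by a subset `G`: the intersection of all
subuniverses containing `G`. -/
def GenSub {A : Type} (I : Interp L A) (G : Set A) : Set A :=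
  {x | ∀ S : Set A, IsSubuniverse I S → G ⊆ S → x ∈ S}

theorem genSub_isSubuniverse {A : Type} (I : Interp L A) (G : Set A) :
    IsSubuniverse I (GenSub I G) :=
  fun f a ha S hS hG => hS f a (fun i => ha i S hS hG)

/-- The smallest congruence containing the pair `(x, y)`: the intersection of all
congruences containing it. -/
def genCong {A : Type} (I : Interp L A) (x y : A) : A → A → Prop :=
  fun w z => ∀ ρ : A → A → Prop, IsCong I ρ → ρ x y → ρ w z

/-- The carrier of `A(θ)`, the graph of `θ` inside `A × A`. -/
abbrev ThetaSub {A : Type} (θ : A → A → Prop) : Type := {z : A × A // θ z.1 z.2}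

/-- The substructure `A(θ) ≤ A × A` supported by the graph of `θ`. -/
def thetaSubInterp {A : Type} (I : Interp L A) (θ : A → A → Prop) (hθ : IsCong I θ) :
    Interp L (ThetaSub θ) :=
  fun f a => ⟨(I f (fun i => (a i).1.1), I f (fun i => (a i).1.2)),
    hθ.2 f _ _ (fun i => (a i).2)⟩

/-- The diagonal element `(c, c)` of `A(θ)`. -/
def diagEl {A : Type} {θ : A → A → Prop} (hrefl : ∀ a : A, θ a a) (c : A) :
    ThetaSub θ := ⟨(c, c), hrefl c⟩

/-- `Δ`: the smallest congruence of `A(θ)` containing `D × D`, where `D` is the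
diagonal -- the intersection of all congruences of `A(θ)` containing `D × D`. -/
def DeltaRel {A : Type} (I : Interp L A) (θ : A → A → Prop) (hθ : IsCong I θ) :
    ThetaSub θ → ThetaSub θ → Prop :=
  fun x y => ∀ ρ : ThetaSub θ → ThetaSub θ → Prop,
    IsCong (thetaSubInterp I θ hθ) ρ →
    (∀ c d : A, ρ (diagEl hθ.1.refl c) (diagEl hθ.1.refl d)) → ρ x y

/-- The quotient algebra `S = A(θ)/Δ`. -/
noncomputable def SInterp {A : Type} (I : Interp L A) (θ : A → A → Prop)
    (hθ : IsCong I θ) : Interp L (Quot (DeltaRel I θ hθ)) :=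
  quotInterp (thetaSubInterp I θ hθ) (DeltaRel I θ hθ)

/-- The element `0` of `S = A(θ)/Δ`: the `Δ`-class of a diagonal element. -/
def zeroS {A : Type} (I : Interp L A) (θ : A → A → Prop) (hθ : IsCong I θ) (d : A) :
    Quot (DeltaRel I θ hθ) :=
  Quot.mk _ (diagEl hθ.1.refl d)

/-- The diagonal of `B × B`. -/
def diagSet (B : Type) : Set (B × B) := {z | z.1 = z.2}

/-- The set of pairs `(u j, v j)`. -/
def pairsSet {B : Type} {l : ℕ} (u v : Fin l → B) : Set (B × B) :=
  {z | ∃ j, z = (u j, v j)}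

/-- The carrier of the subalgebra `C ≤ B × B` generated by the diagonal and the
pairs `(u j, v j)`. -/
def CsetOf {L : Lang} {B : Type} (I : Interp L B) {l : ℕ} (u v : Fin l → B) :
    Set (B × B) :=
  GenSub (pairInterp I) (diagSet B ∪ pairsSet u v)

/-- The subalgebra `C ≤ B × B` generated by the diagonal and the pairs `(u j, v j)`. -/
def CInterpOf {L : Lang} {B : Type} (I : Interp L B) {l : ℕ} (u v : Fin l → B) :
    Interp L (CsetOf I u v) :=
  subInterp (pairInterp I) _ (genSub_isSubuniverse _ _)

theorem Term.realize_relabel {A X Y : Type} (I : Interp L A) (g : X → Y) (v : Y → A)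
    (t : Term L X) : (t.relabel g).realize I v = t.realize I (v ∘ g) := by
  induction t with
  | var x => rfl
  | app f ts ih => simp only [Term.relabel, Term.realize, ih]

/-- Substitution of terms for the variables of a term. -/
def Term.subst {X Y : Type} (g : X → Term L Y) : Term L X → Term L Y
  | .var x => g x
  | .app f ts => .app f (fun i => (ts i).subst g)

theorem Term.realize_subst {A X Y : Type} (I : Interp L A) (g : X → Term L Y) (v : Y → A)
    (t : Term L X) :
    (t.subst g).realize I v = t.realize I (fun x => (g x).realize I v) := by
  induction t with
  | var x => rfl
  | app f ts ih => simp only [Term.subst, Term.realize, ih]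

/-- A term in variables `X ⊕ Y`, with `X` and `Y` finite, gives a polynomial operation whose
arguments are indexed by `Fin k ⊕ Fin l`. -/
theorem isPolyOp_realize_relabel {A X Y : Type} {k l : ℕ} (I : Interp L A)
    (t : Term L (X ⊕ Y)) (e : X ≃ Fin k) (e' : Y ≃ Fin l) :
    IsPolyOp I (fun z : (Fin k ⊕ Fin l) → A => t.realize I (z ∘ Sum.map e e')) :=
  ⟨0, t.relabel (Sum.inl ∘ Sum.map e e'), Fin.elim0, fun z => by
    rw [Term.realize_relabel, ← Function.comp_assoc, Sum.elim_comp_inl]⟩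

theorem sumElim_comp_symm {A X Y X' Y' : Type} (e : X ≃ X') (e' : Y ≃ Y') (a : X → A)
    (u : Y → A) : Sum.elim (a ∘ e.symm) (u ∘ e'.symm) ∘ Sum.map e e' = Sum.elim a u := by
  ext (x | y) <;> simp

theorem IsAbelian.realize_eq {A X Y : Type} [Finite X] [Finite Y] {I : Interp L A}
    (hA : IsAbelian I) (t : Term L (X ⊕ Y)) {a : X → A} (b : X → A) {u v : Y → A}
    (h : t.realize I (Sum.elim a u) = t.realize I (Sum.elim a v)) :
    t.realize I (Sum.elim b u) = t.realize I (Sum.elim b v) := by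
  obtain ⟨k, ⟨e⟩⟩ := Finite.exists_equiv_fin X
  obtain ⟨l, ⟨e'⟩⟩ := Finite.exists_equiv_fin Y
  exact hA _ _ _ _ ⟨k, l, _, isPolyOp_realize_relabel I t e e', a ∘ e.symm, b ∘ e.symm,
    u ∘ e'.symm, v ∘ e'.symm, by simp only [sumElim_comp_symm],
    by simp only [sumElim_comp_symm], by simp only [sumElim_comp_symm],
    by simp only [sumElim_comp_symm]⟩ h

theorem IsStronglyAbelianCong.realize_eq {A X Y : Type} [Finite X] [Finite Y]
    {I : Interp L A} {θ : A → A → Prop} (hsa : IsStronglyAbelianCong I θ)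
    (t : Term L (X ⊕ Y)) {a b : X → A} {u v : Y → A}
    (hab : ∀ x, θ (a x) (b x)) (huv : ∀ y, θ (u y) (v y))
    (h : t.realize I (Sum.elim a v) = t.realize I (Sum.elim b u)) :
    t.realize I (Sum.elim b u) = t.realize I (Sum.elim b v) := by
  obtain ⟨k, ⟨e⟩⟩ := Finite.exists_equiv_fin X
  obtain ⟨l, ⟨e'⟩⟩ := Finite.exists_equiv_fin Y
  exact (hsa (t.realize I (Sum.elim a u)) _ _ _
    ⟨k, l, _, isPolyOp_realize_relabel I t e e', a ∘ e.symm, b ∘ e.symm,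
    u ∘ e'.symm, v ∘ e'.symm, fun _ => hab _, fun _ => huv _,
    by simp only [sumElim_comp_symm],
    by simp only [sumElim_comp_symm], by simp only [sumElim_comp_symm],
    by simp only [sumElim_comp_symm]⟩).2 h

/-- A preorder compatible with an operation in each variable separately is compatible with
the operation. -/
theorem rel_of_rel_update {ι B : Type} [Fintype ι] [DecidableEq ι] {ρ : B → B → Prop}
    (hrefl : ∀ x, ρ x x) (htrans : ∀ {x y z}, ρ x y → ρ y z → ρ x z) (F : (ι → B) → B)
    (hF : ∀ (c : ι → B) (i : ι) (x : B), ρ (c i) x → ρ (F c) (F (Function.update c i x)))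
    {a b : ι → B} (h : ∀ i, ρ (a i) (b i)) : ρ (F a) (F b) := by
  have key : ∀ s : Finset ι, ρ (F a) (F (s.piecewise b a)) := by
    intro s
    induction s using Finset.induction_on with
    | empty => simpa using hrefl (F a)
    | insert j s hj ih =>
      rw [Finset.piecewise_insert]
      refine htrans ih (hF _ _ _ ?_)
      rw [Finset.piecewise_eq_of_notMem _ _ _ hj]
      exact h j
  simpa using key Finset.univ

section Delta

variable {A : Type} {I : Interp L A} {θ : A → A → Prop}

theorem deltaRel_isCong (hθ : IsCong I θ) :
    IsCong (thetaSubInterp I θ hθ) (DeltaRel I θ hθ) :=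
  ⟨⟨fun x _ hρ _ => hρ.1.refl x, fun h ρ hρ hD => hρ.1.symm (h ρ hρ hD),
    fun h h' ρ hρ hD => hρ.1.trans (h ρ hρ hD) (h' ρ hρ hD)⟩,
    fun f a b h ρ hρ hD => hρ.2 f a b fun i => h i ρ hρ hD⟩

theorem quot_mk_deltaRel_eq_iff (hθ : IsCong I θ) {x y : ThetaSub θ} :
    Quot.mk (DeltaRel I θ hθ) x = Quot.mk (DeltaRel I θ hθ) y ↔ DeltaRel I θ hθ x y :=
  ⟨fun h => (deltaRel_isCong hθ).1.eqvGen_iff.1 (Quot.eqvGen_exact h), Quot.sound⟩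

/-- Two elements of `A(θ)` are related if no unary polynomial operation of `A(θ)`
separates them with respect to the diagonal. -/
def DiagSyntactic (I : Interp L A) (θ : A → A → Prop) (x y : ThetaSub θ) : Prop :=
  ∀ (V : Type) [Finite V] (t : Term L (Unit ⊕ V)) (e f : V → A), (∀ v, θ (e v) (f v)) →
    (t.realize I (Sum.elim (fun _ => x.1.1) e) = t.realize I (Sum.elim (fun _ => x.1.2) f) ↔
      t.realize I (Sum.elim (fun _ => y.1.1) e) = t.realize I (Sum.elim (fun _ => y.1.2) f))

theorem diagSyntactic_isCong (hθ : IsCong I θ) :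
    IsCong (thetaSubInterp I θ hθ) (DiagSyntactic I θ) := by
  have equiv : Equivalence (DiagSyntactic I θ) :=
    ⟨fun x V _ t e f _ => Iff.rfl, fun h V _ t e f hef => (h V t e f hef).symm,
      fun h h' V _ t e f hef => (h V t e f hef).trans (h' V t e f hef)⟩
  refine ⟨equiv, fun g a b hab => rel_of_rel_update equiv.refl equiv.trans _ ?_ hab⟩
  intro c i x hx V _ t e f hef
  let σ : Unit ⊕ V → Term L (Unit ⊕ (V ⊕ Fin (L.arity g))) :=
    Sum.elim
      (fun _ => .app g fun j => if j = i then .var (.inl ()) else .var (.inr (.inr j)))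
      (fun v => .var (.inr (.inl v)))
  have key : ∀ (z : A) (w : V → A) (r : Fin (L.arity g) → A),
      (t.subst σ).realize I (Sum.elim (fun _ => z) (Sum.elim w r)) =
        t.realize I (Sum.elim (fun _ => I g (Function.update r i z)) w) := by
    intro z w r
    rw [Term.realize_subst]
    congr 1
    ext (_ | v)
    · simp only [σ, Sum.elim_inl, Term.realize]
      congr 1
      ext j
      by_cases h : j = i
      · subst h
        simp [Term.realize]
      · simp [h, Term.realize]
    · rfl
  have h := hx (V ⊕ Fin (L.arity g)) (t.subst σ)
    (Sum.elim e fun j => (c j).1.1) (Sum.elim f fun j => (c j).1.2)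
    (by rintro (v | j); exacts [hef v, (c j).2])
  simp only [key] at h
  have hu : ∀ p : ThetaSub θ → A,
      (fun j => p (Function.update c i x j)) =
        Function.update (fun j => p (c j)) i (p x) := by
    intro p
    ext j
    by_cases h : j = i
    · subst h
      simp
    · simp [h]
  have h1 := hu fun z => z.1.1
  have h2 := hu fun z => z.1.2
  simp only [thetaSubInterp, h1, h2]
  have h3 := Function.update_eq_self i fun j => (c j).1.1
  have h4 := Function.update_eq_self i fun j => (c j).1.2
  simpa only [h3, h4] using h

theorem diagSyntactic_diagEl (hA : IsAbelian I) (hθ : IsCong I θ) (c d : A) :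
    DiagSyntactic I θ (diagEl hθ.1.refl c) (diagEl hθ.1.refl d) :=
  fun _ _ t _ _ _ => ⟨hA.realize_eq t _, hA.realize_eq t _⟩

/-- In an abelian algebra the diagonal is a single `Δ`-class. -/
theorem quot_mk_eq_zeroS_iff (hA : IsAbelian I) (hθ : IsCong I θ) (x : ThetaSub θ) (d : A) :
    Quot.mk (DeltaRel I θ hθ) x = zeroS I θ hθ d ↔ x.1.1 = x.1.2 := by
  refine (quot_mk_deltaRel_eq_iff hθ).trans ⟨fun h => ?_, fun h => ?_⟩
  · exact (h _ (diagSyntactic_isCong hθ) (diagSyntactic_diagEl hA hθ) Empty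
      (.var (.inl ())) Empty.elim Empty.elim (fun v => v.elim)).2 rfl
  · obtain ⟨⟨y, z⟩, hyz⟩ := x
    obtain rfl : y = z := h
    exact fun ρ _ hD => hD y d

theorem realize_thetaSubInterp (hθ : IsCong I θ) {X : Type} (t : Term L X)
    (w : X → ThetaSub θ) :
    (t.realize (thetaSubInterp I θ hθ) w).1 =
      (t.realize I fun x => (w x).1.1, t.realize I fun x => (w x).1.2) := by
  induction t with
  | var x => rfl
  | app f ts ih => simp only [Term.realize, thetaSubInterp, ih]

theorem realize_SInterp (hθ : IsCong I θ) {X : Type} (t : Term L X) (w : X → ThetaSub θ) :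
    t.realize (SInterp I θ hθ) (fun x => Quot.mk _ (w x)) =
      Quot.mk _ (t.realize (thetaSubInterp I θ hθ) w) := by
  induction t with
  | var x => rfl
  | app f ts ih =>
    simp only [Term.realize, ih]
    refine Quot.sound ((deltaRel_isCong hθ).2 f _ _ fun i => ?_)
    exact (quot_mk_deltaRel_eq_iff hθ).1 (Quot.out_eq _)

/-- A term operation of `S` vanishes iff the two coordinates of the value in `A(θ)` agree. -/
theorem realize_SInterp_eq_zeroS_iff (hA : IsAbelian I) (hθ : IsCong I θ) {X Y : Type}
    (t : Term L (X ⊕ Y)) (w : X → ThetaSub θ) (z : Y → ThetaSub θ) (d : A) :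
    t.realize (SInterp I θ hθ) (Sum.elim (fun x => Quot.mk _ (w x)) fun y => Quot.mk _ (z y)) =
        zeroS I θ hθ d ↔
      t.realize I (Sum.elim (fun x => (w x).1.1) fun y => (z y).1.1) =
        t.realize I (Sum.elim (fun x => (w x).1.2) fun y => (z y).1.2) := by
  have hcomp : ∀ {B : Type} (p : ThetaSub θ → B),
      (Sum.elim (fun x => p (w x)) fun y => p (z y)) = fun q => p (Sum.elim w z q) := by
    intro B p
    ext (x | y) <;> rfl
  have h1 := hcomp (Quot.mk (DeltaRel I θ hθ))
  have h2 := hcomp fun q => q.1.1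
  have h3 := hcomp fun q => q.1.2
  rw [h1, h2, h3, realize_SInterp, quot_mk_eq_zeroS_iff hA, realize_thetaSubInterp]

end Delta

/-- For an abelian algebra `A` and a nontrivial strongly abelian congruence
`θ`, the quotient `S = A(θ)/Δ` has Property P: if a polynomial operation of `S` takes
the value `0` at some tuple, then it takes the value `0` at `(0, …, 0)`. -/
theorem statement7 {L : Lang} {A : Type} (I : Interp L A) (hA : IsAbelian I)
    (θ : A → A → Prop) (hθ : IsCong I θ)
    (hnontriv : ∃ x y : A, θ x y ∧ x ≠ y)
    (hsa : IsStronglyAbelianCong I θ) :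
    ∀ (n : ℕ) (P : (Fin n → Quot (DeltaRel I θ hθ)) → Quot (DeltaRel I θ hθ)),
      IsPolyOp (SInterp I θ hθ) P →
      ∀ (d : A) (s : Fin n → Quot (DeltaRel I θ hθ)),
        P s = zeroS I θ hθ d →
        P (fun _ => zeroS I θ hθ d) = zeroS I θ hθ d := by
  rintro n P ⟨m, t, c, hP⟩ d s hs
  obtain ⟨w, rfl⟩ : ∃ w : Fin n → ThetaSub θ, s = fun i => Quot.mk _ (w i) :=
    ⟨fun i => (s i).out, funext fun i => (Quot.out_eq (s i)).symm⟩
  obtain ⟨z, rfl⟩ : ∃ z : Fin m → ThetaSub θ, c = fun j => Quot.mk _ (z j) :=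
    ⟨fun j => (c j).out, funext fun j => (Quot.out_eq (c j)).symm⟩
  rw [hP, realize_SInterp_eq_zeroS_iff hA] at hs
  rw [hP]
  refine (realize_SInterp_eq_zeroS_iff hA hθ t (fun _ => diagEl hθ.1.refl d) z d).2 ?_
  exact hA.realize_eq t _ (hsa.realize_eq t (fun i => hθ.1.symm (w i).2)
    (fun j => (z j).2) hs.symm)

end UA
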